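/- arXiv:2410.12282 — 2 statements merged into one kernel-verified Lean document; each statement's English description precedes it below -/
import Mathlib

section
/- Let n ≥ 2 and let g be a central element of the special unitary group SU(n) (so g = ζ·I with ζ an n-th root of unity). Then μ²(α⁻¹(g)) = 0, where μ is the normalized Haar measure on SU(n). -/
open MeasureTheory

/-- The special unitary group `SU(n)`: the subgroup of the unitary group
`Matrix.unitaryGroup (Fin n) ℂ` consisting of matrices of determinant `1`. -/
def SU (n : ℕ) : Subgroup (Matrix.unitaryGroup (Fin n) ℂ) where
  carrier := {A | (A : Matrix (Fin n) (Fin n) ℂ).det = 1}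
  one_mem' := by simp
  mul_mem' := by
    intro a b ha hb
    simp only [Set.mem_setOf_eq, Submonoid.coe_mul, Matrix.det_mul] at *
    rw [ha, hb, mul_one]
  inv_mem' := by
    intro a ha
    simp only [Set.mem_setOf_eq] at *
    have : ((a⁻¹ : Matrix.unitaryGroup (Fin n) ℂ) : Matrix (Fin n) (Fin n) ℂ)
        = star (a : Matrix (Fin n) (Fin n) ℂ) := rfl
    rw [this]
    show Matrix.det (Matrix.conjTranspose (a : Matrix (Fin n) (Fin n) ℂ)) = 1
    rw [Matrix.det_conjTranspose, ha, star_one]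

noncomputable instance (n : ℕ) : MeasurableSpace (SU n) := borel (SU n)

instance (n : ℕ) : BorelSpace (SU n) := ⟨rfl⟩

/-- The diagonal unitary matrix with entries `exp (i c k)`. -/
noncomputable def torU (n : ℕ) (c : Fin n → ℝ) : Matrix.unitaryGroup (Fin n) ℂ :=
  ⟨Matrix.diagonal fun k => Complex.exp (c k * Complex.I), by
    rw [Matrix.mem_unitaryGroup_iff, Matrix.star_eq_conjTranspose, Matrix.diagonal_conjTranspose,
      Matrix.diagonal_mul_diagonal, ← Matrix.diagonal_one]
    congr 1
    funext k
    simp only [Pi.star_apply, RCLike.star_def]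
    rw [← Complex.exp_conj, ← Complex.exp_add]
    simp⟩

lemma torU_pow (n m : ℕ) (c : Fin n → ℝ) : (torU n c) ^ m = torU n (fun k => m * c k) := by
  apply Subtype.ext
  rw [SubmonoidClass.coe_pow]
  simp only [torU, Matrix.diagonal_pow]
  congr 1
  funext k
  simp only [Pi.pow_apply]
  rw [← Complex.exp_nat_mul]
  push_cast
  ring_nf

/-- The conjugate torus element. -/
noncomputable def conjTor (n : ℕ) (U : Matrix.unitaryGroup (Fin n) ℂ) (c : Fin n → ℝ)
    (hc : ∑ k, c k = 0) : SU n :=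
  ⟨U * torU n c * U⁻¹, by
    show Matrix.det _ = 1
    have h1 : (U : Matrix (Fin n) (Fin n) ℂ).det *
        ((U⁻¹ : Matrix.unitaryGroup (Fin n) ℂ) : Matrix (Fin n) (Fin n) ℂ).det = 1 := by
      rw [← Matrix.det_mul, ← Submonoid.coe_mul]; simp
    have h2 : (torU n c : Matrix (Fin n) (Fin n) ℂ).det = 1 := by
      simp only [torU, Matrix.det_diagonal]
      rw [← Complex.exp_sum, ← Finset.sum_mul, ← Complex.ofReal_sum, hc]; simp
    rw [Submonoid.coe_mul, Submonoid.coe_mul, Matrix.det_mul, Matrix.det_mul, h2, mul_one, h1]⟩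

lemma conjTor_mem (n : ℕ) (H : Subgroup (SU n)) [H.FiniteIndex]
    (U : Matrix.unitaryGroup (Fin n) ℂ) (c : Fin n → ℝ)
    (hc : ∑ k, c k = 0) : conjTor n U c hc ∈ H := by
  have hm : H.normalCore.index ≠ 0 := Subgroup.FiniteIndex.index_ne_zero
  set m := H.normalCore.index with hmdef
  have hc' : ∑ k, (m : ℝ)⁻¹ * c k = 0 := by rw [← Finset.mul_sum, hc, mul_zero]
  have h : conjTor n U c hc = (conjTor n U (fun k => (m : ℝ)⁻¹ * c k) hc') ^ m := by
    apply Subtype.ext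
    rw [SubmonoidClass.coe_pow]
    simp only [conjTor]
    rw [conj_pow, torU_pow]
    congr 4
    funext k
    field_simp
  rw [h]
  exact H.normalCore_le (Subgroup.pow_index_mem _ _)

/-- Specific angle vector. -/
noncomputable def ang (n : ℕ) (i j : Fin n) : Fin n → ℝ := Pi.single i 1 - Pi.single j 1

lemma ang_sum (n : ℕ) (i j : Fin n) : ∑ k, ang n i j k = 0 := by
  simp [ang]

lemma exp_ne : Complex.exp ((1 : ℝ) * Complex.I) ≠ Complex.exp ((-1 : ℝ) * Complex.I) := by
  intro h
  have := congrArg Complex.im h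
  rw [Complex.exp_ofReal_mul_I_im, Complex.exp_ofReal_mul_I_im, Real.sin_neg] at this
  have := Real.sin_pos_of_pos_of_lt_pi one_pos (by linarith [Real.pi_gt_three])
  linarith

lemma offdiag (n : ℕ) (i j : Fin n) (hij : i ≠ j) (y : Matrix (Fin n) (Fin n) ℂ)
    (h : y * (torU n (ang n i j) : Matrix (Fin n) (Fin n) ℂ) = torU n (ang n i j) * y) :
    y i j = 0 := by
  have := congrFun (congrFun h i) j
  simp only [torU, Matrix.mul_diagonal, Matrix.diagonal_mul] at this
  have e1 : ang n i j i = 1 := by simp [ang, hij]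
  have e2 : ang n i j j = -1 := by simp [ang, hij.symm]
  rw [e1, e2] at this
  by_contra hy
  apply exp_ne
  apply mul_right_cancel₀ hy
  rw [← this, mul_comm]

lemma offdiag' (n : ℕ) (i j : Fin n) (hij : i ≠ j) (x U : Matrix.unitaryGroup (Fin n) ℂ)
    (h : x * (U * torU n (ang n i j) * U⁻¹) = (U * torU n (ang n i j) * U⁻¹) * x) :
    ((U⁻¹ * x * U : Matrix.unitaryGroup (Fin n) ℂ) : Matrix (Fin n) (Fin n) ℂ) i j = 0 := by
  apply offdiag n i j hij
  rw [← Submonoid.coe_mul, ← Submonoid.coe_mul]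
  congr 1
  calc U⁻¹ * x * U * torU n (ang n i j) = U⁻¹ * (x * (U * torU n (ang n i j) * U⁻¹)) * U := by group
    _ = _ := by rw [h]; group

/-- The reflection matrix mixing coordinates. -/
noncomputable def hvec (n : ℕ) (i j : Fin n) : Fin n → ℂ :=
  Pi.single i (3 / 5) + Pi.single j (4 / 5)

lemma hvec_star (n : ℕ) (i j : Fin n) : star (hvec n i j) = hvec n i j := by
  funext k
  simp only [hvec, Pi.star_apply, Pi.add_apply, Pi.single_apply]
  split_ifs <;> simp

lemma hvec_dot (n : ℕ) (i j : Fin n) (hij : i ≠ j) : hvec n i j ⬝ᵥ hvec n i j = 1 := by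
  simp [hvec, hij, hij.symm]
  norm_num

noncomputable def hMat (n : ℕ) (i j : Fin n) : Matrix (Fin n) (Fin n) ℂ :=
  1 - (2 : ℂ) • Matrix.vecMulVec (hvec n i j) (hvec n i j)

lemma hMat_star (n : ℕ) (i j : Fin n) : star (hMat n i j) = hMat n i j := by
  simp [hMat, Matrix.star_eq_conjTranspose, Matrix.conjTranspose_vecMulVec, hvec_star]

lemma hMat_sq (n : ℕ) (i j : Fin n) (hij : i ≠ j) : hMat n i j * hMat n i j = 1 := by
  have : Matrix.vecMulVec (hvec n i j) (hvec n i j) * Matrix.vecMulVec (hvec n i j) (hvec n i j)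
      = Matrix.vecMulVec (hvec n i j) (hvec n i j) := by
    rw [Matrix.vecMulVec_mul_vecMulVec, hvec_dot n i j hij]; simp
  simp only [hMat, sub_mul, mul_sub, one_mul, mul_one, smul_mul_assoc, mul_smul_comm, this]
  module

noncomputable def hU (n : ℕ) (i j : Fin n) (hij : i ≠ j) : Matrix.unitaryGroup (Fin n) ℂ :=
  ⟨hMat n i j, by rw [Matrix.mem_unitaryGroup_iff, hMat_star, hMat_sq n i j hij]⟩

lemma scalar_of_comm (n : ℕ) (x : Matrix.unitaryGroup (Fin n) ℂ)
    (h : ∀ U c, ∑ k, c k = 0 → x * (U * torU n c * U⁻¹) = (U * torU n c * U⁻¹) * x) :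
    (∀ i j, i ≠ j → (x : Matrix (Fin n) (Fin n) ℂ) i j = 0) ∧
    ∀ i j, (x : Matrix (Fin n) (Fin n) ℂ) i i = (x : Matrix (Fin n) (Fin n) ℂ) j j := by
  have hd : ∀ i j, i ≠ j → (x : Matrix (Fin n) (Fin n) ℂ) i j = 0 := by
    intro i j hij
    have := offdiag' n i j hij x 1 (h 1 _ (ang_sum n i j))
    simpa using this
  refine ⟨hd, fun i j => ?_⟩
  by_cases hij : i = j
  · rw [hij]
  have := offdiag' n i j hij x (hU n i j hij) (h _ _ (ang_sum n i j))
  have hx : (x : Matrix (Fin n) (Fin n) ℂ) =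
      Matrix.diagonal fun k => (x : Matrix (Fin n) (Fin n) ℂ) k k := by
    ext a b
    by_cases hab : a = b
    · simp [hab]
    · simp [hab, hd a b hab]
  have hinv : (((hU n i j hij)⁻¹ : Matrix.unitaryGroup (Fin n) ℂ) : Matrix (Fin n) (Fin n) ℂ)
      = hMat n i j := hMat_star n i j
  have hc : ((hU n i j hij : Matrix.unitaryGroup (Fin n) ℂ) : Matrix (Fin n) (Fin n) ℂ)
      = hMat n i j := rfl
  rw [Submonoid.coe_mul, Submonoid.coe_mul, hinv, hc, hx, Matrix.mul_apply] at this
  simp only [Matrix.mul_diagonal] at this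
  rw [← Finset.sum_subset (Finset.subset_univ {i, j}), Finset.sum_pair hij] at this
  · simp [hMat, hvec, Matrix.vecMulVec_apply, hij, Ne.symm hij, Matrix.one_apply] at this
    linear_combination (-625 / 168 : ℂ) * this
  · intro k _ hk
    simp only [Finset.mem_insert, Finset.mem_singleton, not_or] at hk
    simp [hMat, hvec, Matrix.vecMulVec_apply, hk.1, hk.2, Ne.symm hk.1, Matrix.one_apply]

lemma central_of_comm (n : ℕ) (x : SU n)
    (h : ∀ U c hc, conjTor n U c hc ∈ Subgroup.centralizer {x}) :
    x ∈ Subgroup.center (SU n) ∧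
    ∀ i j, ((x : Matrix.unitaryGroup (Fin n) ℂ) : Matrix (Fin n) (Fin n) ℂ) i i
      = ((x : Matrix.unitaryGroup (Fin n) ℂ) : Matrix (Fin n) (Fin n) ℂ) j j := by
  obtain ⟨h1, h2⟩ := scalar_of_comm n x (fun U c hc => by
    have := Subgroup.mem_centralizer_singleton_iff.mp (h U c hc)
    have := congrArg Subtype.val this
    simpa [conjTor] using this.symm)
  refine ⟨?_, h2⟩
  rw [Subgroup.mem_center_iff]
  intro y
  apply Subtype.ext
  apply Subtype.ext
  ext i j
  simp only [Subgroup.coe_mul, Submonoid.coe_mul, Matrix.mul_apply]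
  rw [Finset.sum_eq_single j, Finset.sum_eq_single i, h2 i j, mul_comm]
  · intro k _ hk; rw [h1 _ _ hk.symm, zero_mul]
  · simp
  · intro k _ hk; rw [h1 _ _ hk, mul_zero]
  · simp

lemma not_finiteIndex_center (n : ℕ) (hn : 2 ≤ n) : ¬ (Subgroup.center (SU n)).FiniteIndex := by
  intro hfi
  have hmem := fun U c hc => conjTor_mem n (Subgroup.center (SU n)) U c hc
  let i : Fin n := ⟨0, by omega⟩
  let j : Fin n := ⟨1, by omega⟩
  have hij : i ≠ j := by simp [i, j]
  have h := (central_of_comm n (conjTor n 1 (ang n i j) (ang_sum n i j)) (fun U c hc =>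
    Subgroup.center_le_centralizer _ (hmem U c hc))).2 i j
  have e1 : ang n i j i = 1 := by simp [ang, hij]
  have e2 : ang n i j j = -1 := by simp [ang, hij.symm]
  apply exp_ne
  have h' : (torU n (ang n i j) : Matrix (Fin n) (Fin n) ℂ) i i
      = (torU n (ang n i j) : Matrix (Fin n) (Fin n) ℂ) j j := by
    simpa [conjTor] using h
  simp only [torU, Matrix.diagonal_apply_eq, e1, e2] at h'
  exact h'

lemma finiteIndex_of_measure {G : Type*} [Group G] [MeasurableSpace G] [MeasurableMul G]
    (μ : Measure G) [μ.IsMulLeftInvariant] [IsProbabilityMeasure μ] (H : Subgroup G)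
    (hH : MeasurableSet (H : Set G)) (h0 : μ (H : Set G) ≠ 0) : H.FiniteIndex := by
  have hset : ∀ q : G ⧸ H, (fun y => q.out⁻¹ * y) ⁻¹' (H : Set G)
      = {y : G | (y : G ⧸ H) = q} := by
    intro q
    ext y
    have : ((y : G ⧸ H) = q) ↔ ((q.out : G ⧸ H) = y) := by
      rw [QuotientGroup.out_eq']; exact eq_comm
    show q.out⁻¹ * y ∈ H ↔ ((y : G ⧸ H) = q)
    rw [this, QuotientGroup.eq]
  have hfin := Measure.finite_const_le_meas_of_disjoint_iUnion (μ := μ)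
    (ε := μ (H : Set G)) (pos_iff_ne_zero.mpr h0)
    (As := fun q : G ⧸ H => (fun y => q.out⁻¹ * y) ⁻¹' (H : Set G))
    (fun q => (measurable_const_mul _) hH)
    (by
      intro p q hpq
      simp only [Function.onFun, hset]
      rw [Set.disjoint_left]
      intro y hy hy'
      exact hpq (hy.symm.trans hy'))
    (measure_ne_top _ _)
  have hall : {q : G ⧸ H | μ (H : Set G) ≤ μ ((fun y => q.out⁻¹ * y) ⁻¹' (H : Set G))}
      = Set.univ := by
    ext q
    simp [measure_preimage_mul]
  rw [hall, Set.finite_univ_iff] at hfin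
  exact Subgroup.finiteIndex_of_finite_quotient

instance secondCountable_SU (n : ℕ) : SecondCountableTopology (SU n) := by
  have : SecondCountableTopology (Matrix (Fin n) (Fin n) ℂ) :=
    inferInstanceAs (SecondCountableTopology (Fin n → Fin n → ℂ))
  have : SecondCountableTopology (Matrix.unitaryGroup (Fin n) ℂ) :=
    Topology.IsInducing.subtypeVal.secondCountableTopology
  exact Topology.IsInducing.subtypeVal.secondCountableTopology

lemma isClosed_centralizer' {G : Type*} [Group G] [TopologicalSpace G] [IsTopologicalGroup G]
    [T2Space G] (x : G) : IsClosed (Subgroup.centralizer {x} : Set G) := by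
  have : (Subgroup.centralizer {x} : Set G) = {y | y * x = x * y} := by
    ext y
    exact Subgroup.mem_centralizer_singleton_iff
  rw [this]
  exact isClosed_eq (continuous_mul_const x) (continuous_const_mul x)

/-- For `n ≥ 2` and a central element `g` of `SU(n)`, the fiber of the commutator map over `g`
has measure zero with respect to the (normalized) Haar measure `μ` on `SU(n)`. -/
theorem SU_commutator_fiber_central_measure_zero (n : ℕ) (hn : 2 ≤ n)
    (μ : Measure (SU n)) [μ.IsHaarMeasure] [IsProbabilityMeasure μ]
    (g : SU n) (hg : g ∈ Subgroup.center (SU n)) :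
    (μ.prod μ) {p : SU n × SU n | p.1 * p.2 * p.1⁻¹ * p.2⁻¹ = g} = 0 := by
  have hclosed : IsClosed {p : SU n × SU n | p.1 * p.2 * p.1⁻¹ * p.2⁻¹ = g} :=
    isClosed_eq (by fun_prop) continuous_const
  apply Measure.measure_prod_null_of_ae_null hclosed.measurableSet
  have hcen : IsClosed (Subgroup.center (SU n) : Set (SU n)) := by
    have : (Subgroup.center (SU n) : Set (SU n)) = ⋂ y : SU n, {x | y * x = x * y} := by
      ext x
      simp [Subgroup.mem_center_iff]
    rw [this]
    exact isClosed_iInter fun y => isClosed_eq (by fun_prop) (by fun_prop)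
  have hcen0 : μ (Subgroup.center (SU n) : Set (SU n)) = 0 := by
    by_contra h0
    exact not_finiteIndex_center n hn (finiteIndex_of_measure μ _ hcen.measurableSet h0)
  have hae : ∀ᵐ x ∂μ, x ∉ (Subgroup.center (SU n) : Set (SU n)) :=
    measure_eq_zero_iff_ae_notMem.mp hcen0
  filter_upwards [hae] with x hx
  show μ {y : SU n | x * y * x⁻¹ * y⁻¹ = g} = 0
  have hC : IsClosed (Subgroup.centralizer {x} : Set (SU n)) := isClosed_centralizer' x
  have hC0 : μ (Subgroup.centralizer {x} : Set (SU n)) = 0 := by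
    by_contra h0
    have := finiteIndex_of_measure μ _ hC.measurableSet h0
    exact hx (central_of_comm n x (fun U c hc => conjTor_mem n _ U c hc)).1
  rcases Set.eq_empty_or_nonempty {y : SU n | x * y * x⁻¹ * y⁻¹ = g} with he | ⟨y₀, hy₀⟩
  · rw [he]; simp
  · refine measure_mono_null (t := (fun y => y₀⁻¹ * y) ⁻¹' (Subgroup.centralizer {x} : Set (SU n)))
      ?_ (by rw [measure_preimage_mul]; exact hC0)
    intro y hy
    change x * y * x⁻¹ * y⁻¹ = g at hy
    change x * y₀ * x⁻¹ * y₀⁻¹ = g at hy₀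
    show y₀⁻¹ * y ∈ Subgroup.centralizer {x}
    rw [Subgroup.mem_centralizer_singleton_iff]
    have h : y * x⁻¹ * y⁻¹ = y₀ * x⁻¹ * y₀⁻¹ := by
      have := hy.trans hy₀.symm
      simpa [mul_assoc] using this
    have h2 : y * x * y⁻¹ = y₀ * x * y₀⁻¹ := by
      have := congrArg (·⁻¹) h
      simpa [mul_assoc] using this
    calc y₀⁻¹ * y * x = y₀⁻¹ * (y * x * y⁻¹) * y := by group
      _ = _ := by rw [h2]; group
end

section
/- Let A be a finite group, k ≥ 1, T = (S¹)^k the k-dimensional torus, and G = A × T with normalized Haar measure μ. Then for every X₀ = (a₀, g₀) ∈ G with g₀ = (g₀₁, …, g₀_k), one has μ²(α⁻¹(X₀)) = lim_{n→∞} (1/(|A|·(2n+1)^k)) · Σ_{η} Σ_{m ∈ ℤ^k, |m_j| ≤ n for all j} (η(a₀)/η(1)) · g₀₁^{m₁} ⋯ g₀_k^{m_k}, where the outer sum runs over the characters η of a complete set of representatives of the isomorphism classes of finite-dimensional complex irreducible representations of A. -/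
open MeasureTheory Filter CategoryTheory

noncomputable instance : MeasurableSpace Circle := borel Circle
instance : BorelSpace Circle := ⟨rfl⟩

lemma dirichlet_sum (z : ℂ) (hz0 : z ≠ 0) (n : ℕ) :
    (z - 1) * ∑ m ∈ Finset.Icc (-(n : ℤ)) (n : ℤ), z ^ m = z ^ ((n : ℤ) + 1) - z ^ (-(n : ℤ)) := by
  induction n with
  | zero => simp
  | succ n ih =>
    have h1 : Finset.Icc (-((n + 1 : ℕ) : ℤ)) ((n + 1 : ℕ) : ℤ) =
        insert (-((n : ℤ) + 1)) (insert ((n : ℤ) + 1) (Finset.Icc (-(n : ℤ)) (n : ℤ))) := by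
      ext x
      simp only [Finset.mem_Icc, Finset.mem_insert]
      push_cast
      omega
    rw [h1, Finset.sum_insert, Finset.sum_insert, mul_add, mul_add, ih]
    · have e1 : z ^ (((n + 1 : ℕ) : ℤ) + 1) = z * z ^ ((n : ℤ) + 1) := by
        rw [zpow_add_one₀ hz0, mul_comm]; push_cast; rfl
      have e2 : z ^ (-(n : ℤ)) = z * z ^ (-((n : ℤ) + 1)) := by
        rw [mul_comm, ← zpow_add_one₀ hz0]; congr 1; ring
      rw [e1, e2]; push_cast; ring
    · simp
    · simp only [Finset.mem_Icc, Finset.mem_insert]; omega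

open scoped Classical in
lemma dirichlet_tendsto (z : Circle) :
    Tendsto (fun n : ℕ => (∑ m ∈ Finset.Icc (-(n : ℤ)) (n : ℤ), (z : ℂ) ^ m) / (2 * (n : ℂ) + 1))
      atTop (nhds (if z = 1 then 1 else 0)) := by
  split_ifs with h
  · subst h
    refine tendsto_const_nhds.congr fun n => ?_
    have : (2 * (n : ℂ) + 1) ≠ 0 := by exact_mod_cast (by omega : 2 * n + 1 ≠ 0)
    have h2 : ((n : ℤ) + 1 + (n : ℤ)).toNat = 2 * n + 1 := by omega
    simp only [Circle.coe_one, one_zpow, Finset.sum_const, Int.card_Icc, sub_neg_eq_add, h2, nsmul_eq_mul, mul_one]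
    push_cast
    rw [div_self this]
  · have hz1 : (z : ℂ) - 1 ≠ 0 := by
      intro h'
      apply h
      ext
      simpa [sub_eq_zero] using h'
    rw [tendsto_zero_iff_norm_tendsto_zero]
    have hlim : Tendsto (fun n : ℕ => (2 / ‖(z : ℂ) - 1‖) * (1 / ((n : ℝ) + 1))) atTop (nhds 0) := by
      simpa using (tendsto_one_div_add_atTop_nhds_zero_nat (𝕜 := ℝ)).const_mul (2 / ‖(z : ℂ) - 1‖)
    refine squeeze_zero (fun n => norm_nonneg _) (fun n => ?_) hlim
    have hd := dirichlet_sum (z : ℂ) (Circle.coe_ne_zero z) n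
    have hs : ∑ m ∈ Finset.Icc (-(n : ℤ)) (n : ℤ), (z : ℂ) ^ m =
        ((z : ℂ) ^ ((n : ℤ) + 1) - (z : ℂ) ^ (-(n : ℤ))) / ((z : ℂ) - 1) := by
      rw [← hd]; field_simp
    rw [hs, norm_div, norm_div, div_div, div_mul_div_comm, mul_one]
    have hn : ‖(2 * (n : ℂ) + 1)‖ = 2 * (n : ℝ) + 1 := by
      have : (2 * (n : ℂ) + 1) = ((2 * n + 1 : ℕ) : ℂ) := by push_cast; rfl
      rw [this, Complex.norm_natCast]; push_cast; rfl
    have hp : 0 < ‖(z : ℂ) - 1‖ := norm_pos_iff.mpr hz1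
    rw [hn]
    gcongr
    · refine (norm_sub_le _ _).trans ?_
      simp only [norm_zpow, Circle.norm_coe, one_zpow]; norm_num
    · have : (0 : ℝ) ≤ n := Nat.cast_nonneg n
      linarith

open scoped Classical in
lemma torus_tendsto (k : ℕ) (g : Fin k → Circle) :
    Tendsto (fun n : ℕ => (∑ m ∈ Fintype.piFinset (fun _ : Fin k => Finset.Icc (-(n : ℤ)) (n : ℤ)),
      ∏ j, ((g j : ℂ) ^ (m j))) / (2 * (n : ℂ) + 1) ^ k)
      atTop (nhds (if g = 1 then 1 else 0)) := by
  have h := tendsto_finsetProd (Finset.univ : Finset (Fin k))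
    (fun j _ => dirichlet_tendsto (g j))
  have e : (∏ j : Fin k, (if g j = 1 then (1 : ℂ) else 0)) = if g = 1 then 1 else 0 := by
    rw [Finset.prod_ite_zero]
    simp [funext_iff]
  rw [e] at h
  refine h.congr fun n => ?_
  rw [Finset.prod_div_distrib, Finset.prod_univ_sum]
  simp

open scoped Classical in
lemma fiber_measure {A : Type} [Group A] [Fintype A]
    [TopologicalSpace A] [DiscreteTopology A] [MeasurableSpace A] [BorelSpace A]
    (k : ℕ) (μ : Measure (A × (Fin k → Circle))) [μ.IsHaarMeasure] [IsProbabilityMeasure μ]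
    (X₀ : A × (Fin k → Circle)) :
    ((μ.prod μ)
        {p : (A × (Fin k → Circle)) × (A × (Fin k → Circle)) |
          p.1 * p.2 * p.1⁻¹ * p.2⁻¹ = X₀}).toReal =
      if X₀.2 = 1 then
        ((Finset.univ.filter (fun q : A × A => q.1 * q.2 * q.1⁻¹ * q.2⁻¹ = X₀.1)).card : ℝ)
          / (Fintype.card A : ℝ) ^ 2
      else 0 := by
  set F : A → Set (A × (Fin k → Circle)) := fun a => Prod.fst ⁻¹' {a} with hF
  have hFm : ∀ a, MeasurableSet (F a) := fun a => measurable_fst (measurableSet_singleton a)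
  have hFeq : ∀ a, μ (F a) = μ (F 1) := by
    intro a
    rw [← measure_preimage_mul μ ((a, 1) : A × (Fin k → Circle)) (F a)]
    congr 1
    ext x
    simp [hF]
  have hFr : ∀ a, μ.real (F a) = 1 / (Fintype.card A : ℝ) := by
    have hsum : ∑ a : A, μ.real (F a) = 1 := by
      rw [← measureReal_biUnion_finset]
      · have : (⋃ b ∈ (Finset.univ : Finset A), F b) = Set.univ := by
          ext x; simp [hF]
        rw [this]; simp
      · intro a _ b _ hab
        refine Set.disjoint_left.mpr fun x hx hy => hab ?_
        exact hx.symm.trans hy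
      · intro a _; exact hFm a
    have hc : ∀ a, μ.real (F a) = μ.real (F 1) := fun a => by
      simp only [measureReal_def, hFeq a]
    intro a
    simp only [hc, Finset.sum_const, Finset.card_univ, nsmul_eq_mul] at hsum
    rw [hc a]
    have : (Fintype.card A : ℝ) ≠ 0 := by exact_mod_cast Fintype.card_ne_zero
    field_simp
    linarith
  split_ifs with h
  · have hset : {p : (A × (Fin k → Circle)) × (A × (Fin k → Circle)) |
          p.1 * p.2 * p.1⁻¹ * p.2⁻¹ = X₀} =
        ⋃ q ∈ Finset.univ.filter (fun q : A × A => q.1 * q.2 * q.1⁻¹ * q.2⁻¹ = X₀.1),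
          F q.1 ×ˢ F q.2 := by
      ext p
      have h2 : p.1.2 * p.2.2 * p.1.2⁻¹ * p.2.2⁻¹ = 1 := by
        rw [mul_comm p.1.2 p.2.2]; group
      simp [hF, Prod.ext_iff, h]
    rw [hset, ← measureReal_def, measureReal_biUnion_finset]
    · simp only [measureReal_prod_prod, hFr, Finset.sum_const, nsmul_eq_mul]
      ring
    · intro a _ b _ hab
      refine Set.disjoint_left.mpr fun x hx hy => hab ?_
      exact Prod.ext (hx.1.symm.trans hy.1) (hx.2.symm.trans hy.2)
    · intro q _; exact (hFm _).prod (hFm _)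
  · have hset : {p : (A × (Fin k → Circle)) × (A × (Fin k → Circle)) |
          p.1 * p.2 * p.1⁻¹ * p.2⁻¹ = X₀} = ∅ := by
      ext p
      have h2 : p.1.2 * p.2.2 * p.1.2⁻¹ * p.2.2⁻¹ = 1 := by
        rw [mul_comm p.1.2 p.2.2]; group
      simp only [Set.mem_ofPred_eq, Set.mem_empty_iff_false, iff_false]
      intro hp
      apply h
      rw [← hp]
      exact h2
    rw [hset]; simp

lemma schur_scalar {A : Type} [Group A] (V : FDRep ℂ A) [Simple V]
    (f : V →ₗ[ℂ] V) (hf : ∀ g, f ∘ₗ V.ρ g = V.ρ g ∘ₗ f) : ∃ c : ℂ, f = c • LinearMap.id := by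
  have h1 : Module.finrank ℂ (V ⟶ V) = 1 := finrank_endomorphism_simple_eq_one ℂ V
  let F : V ⟶ V := ⟨InducedCategory.homMk (ModuleCat.ofHom f), fun g => by
    ext1; ext x
    exact LinearMap.congr_fun (hf g) x⟩
  obtain ⟨c, hc⟩ := (finrank_eq_one_iff_of_nonzero' (𝟙 V) (id_nonzero V)).mp h1 F
  refine ⟨c, ?_⟩
  have := congrArg (fun φ : V ⟶ V => φ.hom.hom.hom) hc
  exact this.symm

lemma char_one_ne_zero {A : Type} [Group A] [Fintype A] (V : FDRep ℂ A) [Simple V] :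
    V.character 1 ≠ 0 := by
  intro h
  rw [FDRep.char_one] at h
  have h0 : Module.finrank ℂ V = 0 := by exact_mod_cast h
  have hs : Subsingleton V := Module.finrank_zero_iff.mp h0
  have hn := (FDRep.simple_iff_char_is_norm_one V).mp inferInstance
  have hz : ∀ g, V.character g = 0 := fun g => by
    have : V.ρ g = 0 := Subsingleton.elim _ _
    simp [FDRep.character, this]
  simp only [hz, mul_zero, Finset.sum_const_zero] at hn
  exact (NeZero.ne (Nat.card A : ℂ)) hn.symm

lemma schur_trace {A : Type} [Group A] [Fintype A] (V : FDRep ℂ A) [Simple V]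
    (f : V →ₗ[ℂ] V) (hf : ∀ g, f ∘ₗ V.ρ g = V.ρ g ∘ₗ f) :
    f = (LinearMap.trace ℂ V f / V.character 1) • LinearMap.id := by
  obtain ⟨c, hc⟩ := schur_scalar V f hf
  have h1 := char_one_ne_zero V
  have : LinearMap.trace ℂ V f = c * V.character 1 := by
    rw [hc, map_smul, smul_eq_mul, FDRep.char_one, LinearMap.trace_id]
  rw [this, mul_div_assoc, div_self h1, mul_one]
  exact hc

/-- A class function acts by a scalar. -/
lemma class_sum {A : Type} [Group A] [Fintype A] (V : FDRep ℂ A) [Simple V]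
    (c : A → ℂ) (hc : ∀ g h, c (h * g * h⁻¹) = c g) :
    ∑ g, c g • V.ρ g = ((∑ g, c g * V.character g) / V.character 1) • LinearMap.id := by
  have h := schur_trace V (∑ g, c g • V.ρ g) (fun h => by
    change (∑ g, c g • V.ρ g) * V.ρ h = V.ρ h * (∑ g, c g • V.ρ g)
    rw [Finset.sum_mul, Finset.mul_sum]
    refine (Fintype.sum_equiv (MulAut.conj h).toEquiv _ _ fun g => ?_).symm
    simp only [MulEquiv.toEquiv_eq_coe, EquivLike.coe_coe, MulAut.conj_apply, hc,
      mul_smul_comm, smul_mul_assoc, ← map_mul]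
    simp)
  rw [h]
  simp [FDRep.character, map_sum]

lemma conj_sum {A : Type} [Group A] [Fintype A] (V : FDRep ℂ A) [Simple V] (y : A) :
    ∑ x, V.ρ (x * y * x⁻¹) =
      ((Fintype.card A * V.character y) / V.character 1) • LinearMap.id := by
  have h := schur_trace V (∑ x, V.ρ (x * y * x⁻¹)) (fun h => by
    change (∑ x, V.ρ (x * y * x⁻¹)) * V.ρ h = V.ρ h * (∑ x, V.ρ (x * y * x⁻¹))
    rw [Finset.sum_mul, Finset.mul_sum]
    refine (Fintype.sum_equiv (Equiv.mulLeft h) _ _ fun g => ?_).symm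
    simp only [Equiv.coe_mulLeft, ← map_mul]
    congr 1
    group)
  rw [h]
  congr 2
  rw [map_sum]
  have : ∀ x, LinearMap.trace ℂ V (V.ρ (x * y * x⁻¹)) = V.character y :=
    fun x => FDRep.char_conj V y x
  simp only [this, Finset.sum_const, Finset.card_univ, nsmul_eq_mul]

lemma comm_char_sum {A : Type} [Group A] [Fintype A] (V : FDRep ℂ A) [Simple V] (a : A) :
    ∑ x, ∑ y, V.character (x * y * x⁻¹ * y⁻¹ * a) =
      (Fintype.card A : ℂ) ^ 2 * V.character a / V.character 1 ^ 2 := by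
  have h1 := char_one_ne_zero V
  have hn := (FDRep.simple_iff_char_is_norm_one V).mp inferInstance
  have e1 : ∑ y, V.character y⁻¹ • V.ρ y =
      ((Fintype.card A : ℂ) / V.character 1) • LinearMap.id := by
    rw [class_sum V (fun y => V.character y⁻¹) (fun g h => by
      have : (h * g * h⁻¹)⁻¹ = h * g⁻¹ * h⁻¹ := by group
      simp only [this, FDRep.char_conj])]
    congr 2
    rw [Nat.card_eq_fintype_card] at hn
    rw [← hn]
    exact Finset.sum_congr rfl fun g _ => mul_comm _ _
  have e2 : ∑ y, ∑ x, V.ρ (x * y * x⁻¹ * y⁻¹ * a) =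
      ((Fintype.card A : ℂ) ^ 2 / V.character 1 ^ 2) • V.ρ a := by
    have : ∀ y, ∑ x, V.ρ (x * y * x⁻¹ * y⁻¹ * a) =
        ((Fintype.card A : ℂ) / V.character 1) • ((V.character y • V.ρ y⁻¹) * V.ρ a) := by
      intro y
      simp only [mul_assoc _ y⁻¹ a, map_mul _ _ (y⁻¹ * a)]
      rw [← Finset.sum_mul, conj_sum]
      rw [map_mul, smul_mul_assoc, smul_mul_assoc, smul_smul]
      congr 1
      ring
    simp only [this]
    rw [← Finset.smul_sum, ← Finset.sum_mul]
    have e3 : ∑ y, V.character y • V.ρ y⁻¹ = ∑ y, V.character y⁻¹ • V.ρ y :=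
      Fintype.sum_equiv (Equiv.inv A) _ _ fun y => by simp
    rw [e3, e1, smul_mul_assoc, smul_smul]
    congr 1
    ring
  rw [Finset.sum_comm]
  have e4 := congrArg (LinearMap.trace ℂ V) e2
  simp only [map_sum, map_smul, smul_eq_mul] at e4
  rw [mul_div_right_comm]
  exact e4

lemma simple_of_irreducible {A : Type} [Group A] [Fintype A] {M : Type} [AddCommGroup M]
    [Module ℂ M] [Module.Finite ℂ M] (ρ : Representation ℂ A M) [ρ.IsIrreducible] :
    Simple (FDRep.of ρ) := by
  rw [FDRep.simple_iff_char_is_norm_one]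
  have := invertibleOfNonzero (NeZero.ne (Nat.card A : ℂ))
  have h := Representation.char_orthonormal ρ ρ
  rw [if_pos ⟨Representation.Equiv.refl ρ⟩] at h
  have h0 : (Nat.card A : ℂ) ≠ 0 := NeZero.ne _
  rw [inv_mul_eq_one₀ h0] at h
  exact h.symm

lemma simple_module_fixed {A : Type} [Group A] [Fintype A] (c : A → ℂ)
    (key : ∀ W : FDRep ℂ A, Simple W → ∑ g, c g • W.ρ g = LinearMap.id)
    (M : Type) [AddCommGroup M] [Module ℂ M] [Module (MonoidAlgebra ℂ A) M]
    [IsScalarTower ℂ (MonoidAlgebra ℂ A) M]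
    [IsSimpleModule (MonoidAlgebra ℂ A) M] (x : M) :
    (∑ g, MonoidAlgebra.single g (c g) : MonoidAlgebra ℂ A) • x = x := by
  have hfin : Module.Finite ℂ M := Module.Finite.trans (MonoidAlgebra ℂ A) M
  let ρ : Representation ℂ A M := Representation.ofModule' M
  have hρ : ∀ (r : MonoidAlgebra ℂ A) (m : M), ρ.asAlgebraHom r m = r • m := by
    intro r m
    have : ρ.asAlgebraHom = Algebra.lsmul ℂ ℂ M := by
      rw [Representation.asAlgebraHom_def]
      exact Equiv.apply_symm_apply _ _
    rw [this]
    rfl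
  let e : ρ.asModule ≃ₗ[MonoidAlgebra ℂ A] M :=
    { ρ.asModuleEquiv.toAddEquiv with
      map_smul' := fun r m => by
        have h := Representation.asModuleEquiv_map_smul ρ r m
        rw [hρ] at h
        exact h }
  have hsm : IsSimpleModule (MonoidAlgebra ℂ A) ρ.asModule := IsSimpleModule.congr e
  have hirr : ρ.IsIrreducible :=
    (Representation.irreducible_iff_isSimpleModule_asModule ρ).mpr hsm
  have h := key (FDRep.of ρ) (simple_of_irreducible ρ)
  have h2 : ρ.asAlgebraHom (∑ g, MonoidAlgebra.single g (c g)) = LinearMap.id := by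
    rw [map_sum]
    simp only [Representation.asAlgebraHom_single]
    exact h
  have h3 := LinearMap.congr_fun h2 x
  rw [hρ] at h3
  exact h3

open scoped Classical in
lemma column_orthogonality {A : Type} [Group A] [Fintype A]
    {ι : Type} [Fintype ι] (V : ι → FDRep ℂ A)
    (hsimple : ∀ i, Simple (V i))
    (hdistinct : ∀ i j : ι, Nonempty (V i ≅ V j) → i = j)
    (hcomplete : ∀ W : FDRep ℂ A, Simple W → ∃ i, Nonempty (W ≅ V i)) (g : A) :
    ∑ i, (V i).character 1 * (V i).character g =
      if g = 1 then (Fintype.card A : ℂ) else 0 := by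
  have h0 : (Fintype.card A : ℂ) ≠ 0 := by exact_mod_cast Fintype.card_ne_zero
  set c : A → ℂ := fun g => (Fintype.card A : ℂ)⁻¹ *
    ∑ i, (V i).character 1 * (V i).character g⁻¹ with hc
  have hcc : ∀ g h, c (h * g * h⁻¹) = c g := fun g h => by
    have : (h * g * h⁻¹)⁻¹ = h * g⁻¹ * h⁻¹ := by group
    simp only [hc, this, FDRep.char_conj]
  have hinv := invertibleOfNonzero (NeZero.ne (Nat.card A : ℂ))
  have key : ∀ W : FDRep ℂ A, Simple W → ∑ g, c g • W.ρ g = LinearMap.id := by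
    intro W hW
    rw [class_sum W c hcc]
    obtain ⟨j, ⟨e⟩⟩ := hcomplete W hW
    have hch : W.character = (V j).character := FDRep.char_iso e
    have : ∑ g, c g * W.character g = W.character 1 := by
      have horth : ∀ i, (Fintype.card A : ℂ)⁻¹ * ∑ g, (V j).character g * (V i).character g⁻¹ =
          if j = i then 1 else 0 := fun i => by
        rw [← Nat.card_eq_fintype_card, FDRep.char_orthonormal (V j) (V i)]
        congr 1
        refine propext ⟨hdistinct j i, ?_⟩
        rintro rfl
        exact ⟨Iso.refl _⟩
      calc ∑ g, c g * W.character g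
          = ∑ i, (V i).character 1 * ((Fintype.card A : ℂ)⁻¹ *
              ∑ g, (V j).character g * (V i).character g⁻¹) := by
            simp only [hc, hch, Finset.mul_sum, Finset.sum_mul]
            rw [Finset.sum_comm]
            refine Finset.sum_congr rfl fun i _ => Finset.sum_congr rfl fun g _ => ?_
            ring
        _ = W.character 1 := by
            simp only [horth, hch]
            simp
    rw [this, div_self (char_one_ne_zero W), one_smul]
  set z : MonoidAlgebra ℂ A := ∑ g, MonoidAlgebra.single g (c g) with hz
  have hz1 : ∀ x : MonoidAlgebra ℂ A, z * x = x := by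
    intro x
    have hx : x ∈ sSup { m : Submodule (MonoidAlgebra ℂ A) (MonoidAlgebra ℂ A) |
        IsSimpleModule (MonoidAlgebra ℂ A) m } := by
      rw [IsSemisimpleModule.sSup_simples_eq_top]; trivial
    rw [sSup_eq_iSup'] at hx
    refine Submodule.iSup_induction _ (motive := fun x => z * x = x) hx ?_ ?_ ?_
    · intro S x hx
      obtain ⟨S, hS⟩ := S
      have hS' : IsSimpleModule (MonoidAlgebra ℂ A) S := hS
      have h3 := simple_module_fixed c key S ⟨x, hx⟩
      exact congrArg Subtype.val h3
    · simp
    · intro x y hx hy; rw [mul_add, hx, hy]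
  have hz2 : z = 1 := by simpa using hz1 1
  have h4 := congrArg (fun w : MonoidAlgebra ℂ A => w.coeff g⁻¹) hz2
  have h5 : z.coeff g⁻¹ = c g⁻¹ := by
    simp [hz, Finsupp.single_apply]
  have h6 : (1 : MonoidAlgebra ℂ A).coeff g⁻¹ = if g = 1 then 1 else 0 := by
    simp [MonoidAlgebra.one_def, Finsupp.single_apply, eq_comm]
  simp only [h5, h6, hc, inv_inv] at h4
  rw [inv_mul_eq_iff_eq_mul₀ h0] at h4
  rw [h4]
  split_ifs <;> simp

open scoped Classical in
lemma frobenius_count {A : Type} [Group A] [Fintype A]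
    {ι : Type} [Fintype ι] (V : ι → FDRep ℂ A)
    (hsimple : ∀ i, Simple (V i))
    (hdistinct : ∀ i j : ι, Nonempty (V i ≅ V j) → i = j)
    (hcomplete : ∀ W : FDRep ℂ A, Simple W → ∃ i, Nonempty (W ≅ V i)) (a : A) :
    ((Finset.univ.filter (fun q : A × A => q.1 * q.2 * q.1⁻¹ * q.2⁻¹ = a)).card : ℂ) =
      Fintype.card A * ∑ i, (V i).character a / (V i).character 1 := by
  have h0 : (Fintype.card A : ℂ) ≠ 0 := by exact_mod_cast Fintype.card_ne_zero
  have h1 : (∑ x : A, ∑ y : A, if x * y * x⁻¹ * y⁻¹ * a = 1 then (Fintype.card A : ℂ) else 0) =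
      (Fintype.card A : ℂ) ^ 2 * ∑ i, (V i).character a / (V i).character 1 := by
    simp only [← column_orthogonality V hsimple hdistinct hcomplete]
    have : ∀ x : A, ∑ y : A, ∑ i, (V i).character 1 * (V i).character (x * y * x⁻¹ * y⁻¹ * a) =
        ∑ i, (V i).character 1 * ∑ y : A, (V i).character (x * y * x⁻¹ * y⁻¹ * a) := fun x => by
      rw [Finset.sum_comm]
      simp only [Finset.mul_sum]
    simp only [this]
    rw [Finset.sum_comm]
    simp only [← Finset.mul_sum, comm_char_sum]
    rw [Finset.mul_sum]
    refine Finset.sum_congr rfl fun i _ => ?_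
    have := char_one_ne_zero (V i)
    field_simp
  have h2 : (∑ x : A, ∑ y : A, if x * y * x⁻¹ * y⁻¹ * a = 1 then (Fintype.card A : ℂ) else 0) =
      Fintype.card A *
      ((Finset.univ.filter (fun q : A × A => q.1 * q.2 * q.1⁻¹ * q.2⁻¹ = a)).card : ℂ) := by
    rw [Finset.card_filter, Fintype.sum_prod_type, Finset.sum_comm]
    push_cast
    simp only [Finset.mul_sum, mul_ite, mul_one, mul_zero]
    refine Finset.sum_congr rfl fun x _ => Finset.sum_congr rfl fun y _ => ?_
    have : (y * x * y⁻¹ * x⁻¹ * a = 1) ↔ (x * y * x⁻¹ * y⁻¹ = a) := by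
      rw [mul_eq_one_iff_inv_eq]
      have : (y * x * y⁻¹ * x⁻¹)⁻¹ = x * y * x⁻¹ * y⁻¹ := by group
      rw [this]
    simp only [this]
  rw [h2, sq, mul_assoc] at h1
  exact mul_left_cancel₀ h0 h1

theorem finite_times_torus_commutator_fiber_measure {A : Type} [Group A] [Fintype A]
    [TopologicalSpace A] [DiscreteTopology A] [MeasurableSpace A] [BorelSpace A]
    (k : ℕ) (hk : 1 ≤ k)
    {ι : Type} [Fintype ι] (V : ι → FDRep ℂ A)
    (hsimple : ∀ i, Simple (V i))
    (hdistinct : ∀ i j : ι, Nonempty (V i ≅ V j) → i = j)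
    (hcomplete : ∀ W : FDRep ℂ A, Simple W → ∃ i, Nonempty (W ≅ V i))
    (μ : Measure (A × (Fin k → Circle))) [μ.IsHaarMeasure] [IsProbabilityMeasure μ]
    (X₀ : A × (Fin k → Circle)) :
    Tendsto
      (fun n : ℕ => (1 / ((Fintype.card A : ℂ) * (2 * (n : ℂ) + 1) ^ k)) *
        ∑ i : ι, ∑ m ∈ Fintype.piFinset (fun _ : Fin k => Finset.Icc (-(n : ℤ)) (n : ℤ)),
          ((V i).character X₀.1 / (V i).character 1) * ∏ j, ((X₀.2 j : ℂ) ^ (m j)))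
      atTop
      (nhds ((((μ.prod μ)
        {p : (A × (Fin k → Circle)) × (A × (Fin k → Circle)) |
          p.1 * p.2 * p.1⁻¹ * p.2⁻¹ = X₀}).toReal : ℂ))) := by
  classical
  have h0 : (Fintype.card A : ℂ) ≠ 0 := by exact_mod_cast Fintype.card_ne_zero
  have hlim := (torus_tendsto k X₀.2).const_mul
    ((1 / (Fintype.card A : ℂ)) * ∑ i, (V i).character X₀.1 / (V i).character 1)
  have hval : (((μ.prod μ)
        {p : (A × (Fin k → Circle)) × (A × (Fin k → Circle)) |
          p.1 * p.2 * p.1⁻¹ * p.2⁻¹ = X₀}).toReal : ℂ) =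
      ((1 / (Fintype.card A : ℂ)) * ∑ i, (V i).character X₀.1 / (V i).character 1) *
        (if X₀.2 = 1 then 1 else 0) := by
    rw [fiber_measure k μ X₀]
    split_ifs with h
    · push_cast
      rw [frobenius_count V hsimple hdistinct hcomplete]
      field_simp
    · simp
  rw [hval]
  refine hlim.congr fun n => ?_
  simp only [← Finset.mul_sum]
  rw [← Finset.sum_mul]
  field_simp
end
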